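/- arXiv:1111.1376 — 3 statements merged into one kernel-verified Lean document; each statement's English description precedes it below -/
import Mathlib

section
/- For all n, k with 2 ≤ n and 1 ≤ k < 2^(n−1), the number σ_{n,k} of separating families of k proper bipartitions of an n-element set satisfies σ_{n,k} = ((n−1)!/k!) · ∑_{i=1}^{k} (−1)^(k−i) · c(k+1, i+1) · C(2^i − 1, n − 1), where c(·,·) is the unsigned Stirling number of the first kind and C(·,·) is the binomial coefficient. -/
open Finset

variable {α : Type*} [DecidableEq α]

/-- A *bipartition* of a finite set `S`: a collection of at most two pairwise disjoint
nonempty subsets of `S` whose union is `S`. -/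
def IsBipartition (S : Finset α) (P : Finset (Finset α)) : Prop :=
  P.card ≤ 2 ∧ (∀ A ∈ P, A.Nonempty) ∧
    (∀ A ∈ P, ∀ B ∈ P, A ≠ B → Disjoint A B) ∧ P.sup id = S

/-- The bipartition `P` *cuts* the elements `x` and `y`:
they lie in different components of `P`. -/
def Cuts (P : Finset (Finset α)) (x y : α) : Prop :=
  ∃ A ∈ P, ∃ B ∈ P, A ≠ B ∧ x ∈ A ∧ y ∈ B

/-- A family `F` of bipartitions is *separating* for `S` if every two distinct
elements of `S` are cut by some member of `F`. -/
def IsSeparating (S : Finset α) (F : Finset (Finset (Finset α))) : Prop :=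
  ∀ x ∈ S, ∀ y ∈ S, x ≠ y → ∃ P ∈ F, Cuts P x y

/-- A separating family is *minimal* if no proper subfamily is separating. -/
def IsMinimalSeparating (S : Finset α) (F : Finset (Finset (Finset α))) : Prop :=
  IsSeparating S F ∧ ∀ F2 ⊂ F, ¬ IsSeparating S F2

/-- `sigmaSep n k` is the number of separating families consisting of `k` proper
bipartitions (bipartitions with exactly two components) of an `n`-element set. -/
noncomputable def sigmaSep (n k : ℕ) : ℕ :=
  Set.ncard {F : Finset (Finset (Finset (Fin n))) |
    (∀ P ∈ F, IsBipartition Finset.univ P ∧ P.card = 2) ∧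
      IsSeparating Finset.univ F ∧ F.card = k}

/-- The unsigned Stirling numbers of the first kind: `stirling1 n k` is the number of
permutations of an `n`-element set with exactly `k` cycles. -/
def stirling1 : ℕ → ℕ → ℕ
  | 0, 0 => 1
  | 0, _ + 1 => 0
  | _ + 1, 0 => 0
  | n + 1, k + 1 => n * stirling1 n (k + 1) + stirling1 n k

theorem stirling1_eq_zero_of_lt : ∀ {n k : ℕ}, n < k → stirling1 n k = 0
  | 0, 0, h => absurd h (lt_irrefl 0)
  | 0, _ + 1, _ => rfl
  | _ + 1, 0, h => absurd h (Nat.not_lt_zero _)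
  | n + 1, k + 1, h => by
    rw [stirling1, stirling1_eq_zero_of_lt (Nat.lt_of_succ_lt_succ h),
      stirling1_eq_zero_of_lt (Nat.lt_of_succ_lt h), mul_zero]

/-- Unrolling the recurrence `N (j + 1) i = N j (i + 1) - (j + 1) * N j i`. -/
theorem eq_sum_stirling1_of_recurrence (N : ℕ → ℕ → ℚ)
    (h : ∀ j i, N (j + 1) i = N j (i + 1) - (j + 1) * N j i) (j i : ℕ) :
    N j i = ∑ l ∈ range (j + 1), (-1 : ℚ) ^ (j + l) * (stirling1 (j + 1) (l + 1) : ℚ) *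
      N 0 (i + l) := by
  induction j generalizing i with
  | zero => simp [stirling1]
  | succ j ih =>
    have hsplit : ∀ l, (-1 : ℚ) ^ (j + 1 + l) * (stirling1 (j + 1 + 1) (l + 1) : ℚ) * N 0 (i + l) =
        (-1 : ℚ) ^ (j + 1 + l) * (stirling1 (j + 1) l : ℚ) * N 0 (i + l) -
        (j + 1) * ((-1 : ℚ) ^ (j + l) * (stirling1 (j + 1) (l + 1) : ℚ) * N 0 (i + l)) := by
      intro l
      rw [stirling1]
      push_cast
      ring
    rw [h, ih, ih, sum_congr rfl fun l _ => hsplit l, sum_sub_distrib, ← mul_sum]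
    congr 1
    · rw [sum_range_succ' _ (j + 1)]
      simp only [stirling1, Nat.cast_zero, mul_zero, zero_mul, add_zero]
      refine sum_congr rfl fun l _ => ?_
      rw [show i + 1 + l = i + (l + 1) by ring]
      ring
    · rw [sum_range_succ _ (j + 1), stirling1_eq_zero_of_lt (Nat.lt_succ_self (j + 1))]
      simp

section Enumeration

variable {T : Type*} [DecidableEq T]

/-- Both sides enumerate pairs of a `(j + 1)`-subset of `U` and one of its elements. -/
theorem sum_powersetCard_sum_insert (U : Finset T) (w : Finset T → ℕ) (j : ℕ) :
    ∑ F ∈ powersetCard j U, ∑ b ∈ U \ F, w (insert b F) =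
      (j + 1) * ∑ F ∈ powersetCard (j + 1) U, w F := by
  have hconst : (j + 1) * ∑ F ∈ powersetCard (j + 1) U, w F =
      ∑ F ∈ powersetCard (j + 1) U, ∑ _b ∈ F, w F := by
    rw [mul_sum]
    refine sum_congr rfl fun F hF => ?_
    rw [sum_const, (mem_powersetCard.1 hF).2, smul_eq_mul]
  rw [hconst, sum_sigma', sum_sigma']
  refine sum_bij' (fun p _ => ⟨insert p.2 p.1, p.2⟩) (fun p _ => ⟨p.1.erase p.2, p.2⟩)
    ?_ ?_ ?_ ?_ ?_
  · rintro ⟨F, b⟩ hp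
    simp only [mem_sigma, mem_powersetCard, mem_sdiff] at hp ⊢
    obtain ⟨⟨hF, hc⟩, hb, hbF⟩ := hp
    exact ⟨⟨insert_subset hb hF, by rw [card_insert_of_notMem hbF, hc]⟩, mem_insert_self _ _⟩
  · rintro ⟨F, b⟩ hp
    simp only [mem_sigma, mem_powersetCard, mem_sdiff] at hp ⊢
    obtain ⟨⟨hF, hc⟩, hb⟩ := hp
    exact ⟨⟨(erase_subset _ _).trans hF, by rw [card_erase_of_mem hb, hc]; rfl⟩, hF hb,
      notMem_erase _ _⟩
  · rintro ⟨F, b⟩ hp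
    simp only [mem_sigma, mem_sdiff] at hp
    simp [erase_insert hp.2.2]
  · rintro ⟨F, b⟩ hp
    simp only [mem_sigma] at hp
    simp [insert_erase hp.2]
  · rintro ⟨F, b⟩ _
    rfl

/-- The number of sequences of length `i` whose entries, together with the elements of `F`,
form a set satisfying `P`. -/
noncomputable def seqCount (P : Finset T → Prop) (i : ℕ) (F : Finset T) : ℕ :=
  Nat.card {g : Fin i → T // P (F ∪ univ.image g)}

theorem seqCount_insert (P : Finset T → Prop) (t₀ : T) (hP : ∀ F, P (insert t₀ F) ↔ P F)
    (i : ℕ) (F : Finset T) : seqCount P i (insert t₀ F) = seqCount P i F := by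
  simp only [seqCount, insert_union, hP]

variable [Fintype T]

theorem sum_powersetCard_erase_sum_insert (t₀ : T) (w : Finset T → ℕ)
    (hw : ∀ F, w (insert t₀ F) = w F) (j : ℕ) :
    ∑ F ∈ powersetCard j (univ.erase t₀), ∑ b, w (insert b F) =
      (j + 1) * ∑ F ∈ powersetCard (j + 1) (univ.erase t₀), w F +
        (j + 1) * ∑ F ∈ powersetCard j (univ.erase t₀), w F := by
  rw [← sum_powersetCard_sum_insert, mul_sum, ← sum_add_distrib]
  refine sum_congr rfl fun F hF => ?_
  obtain ⟨hFU, hc⟩ := mem_powersetCard.1 hF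
  have hF : ∑ b ∈ F, w (insert b F) = j * w F := by
    rw [sum_congr rfl fun b hb => congrArg w (insert_eq_of_mem hb), sum_const, hc, smul_eq_mul]
  rw [← add_sum_erase univ _ (mem_univ t₀), hw, ← sum_sdiff hFU, hF]
  ring

open Classical in
theorem seqCount_zero (P : Finset T → Prop) (F : Finset T) :
    seqCount P 0 F = if P F then 1 else 0 := by
  split_ifs with h <;> simp [seqCount, h]

theorem seqCount_succ (P : Finset T → Prop) (i : ℕ) (F : Finset T) :
    seqCount P (i + 1) F = ∑ b, seqCount P i (insert b F) := by
  unfold seqCount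
  rw [← Nat.card_sigma]
  refine Nat.card_congr (Equiv.trans ((Fin.consEquiv fun _ => T).symm.subtypeEquiv
    (q := fun p => P (insert p.1 F ∪ univ.image p.2)) fun g => ?_)
    (Equiv.subtypeProdEquivSigmaSubtype fun b (g : Fin i → T) => P (insert b F ∪ univ.image g)))
  have : F ∪ univ.image g = insert (g 0) F ∪ univ.image (Fin.tail g) := by
    ext t
    simp only [mem_union, mem_image, mem_univ, true_and, mem_insert, Fin.exists_fin_succ, Fin.tail]
    tauto
  rw [this]
  rfl

open Classical in
/-- If inserting `t₀` does not affect `P`, the number of `k`-subsets avoiding `t₀` that satisfy `P`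
is an alternating sum of the numbers of sequences whose range satisfies `P`. -/
theorem factorial_mul_card_filter_powersetCard (P : Finset T → Prop) (t₀ : T)
    (hP : ∀ F, P (insert t₀ F) ↔ P F) (k : ℕ) :
    (k.factorial : ℚ) * (#{F ∈ powersetCard k (univ.erase t₀) | P F} : ℚ) =
      ∑ l ∈ range (k + 1), (-1 : ℚ) ^ (k + l) * (stirling1 (k + 1) (l + 1) : ℚ) *
        (seqCount P l ∅ : ℚ) := by
  have key := eq_sum_stirling1_of_recurrence
    (fun j i => (j.factorial : ℚ) *
      ((∑ F ∈ powersetCard j (univ.erase t₀), seqCount P i F : ℕ) : ℚ)) ?_ k 0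
  · simpa [seqCount_zero] using key
  · intro j i
    have h := sum_powersetCard_erase_sum_insert t₀ (seqCount P i) (seqCount_insert P t₀ hP i) j
    simp only [← seqCount_succ] at h
    rw [h, Nat.factorial_succ]
    push_cast
    ring

end Enumeration

section Splitting

variable {m : ℕ}

/-- The bipartition of `Fin (m + 1)` into the shifted copy of `A` and its complement,
which contains `0`. -/
def splitting (A : Finset (Fin m)) : Finset (Finset (Fin (m + 1))) :=
  {A.map (Fin.succEmb m), (A.map (Fin.succEmb m))ᶜ}

theorem cuts_splitting (A : Finset (Fin m)) (x y : Fin (m + 1)) :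
    Cuts (splitting A) x y ↔ ¬ (x ∈ A.map (Fin.succEmb m) ↔ y ∈ A.map (Fin.succEmb m)) := by
  have hne : A.map (Fin.succEmb m) ≠ (A.map (Fin.succEmb m))ᶜ := by
    intro h
    have := Finset.ext_iff.1 h x
    rw [mem_compl] at this
    tauto
  have hne' := hne.symm
  simp only [Cuts, splitting, mem_insert, mem_singleton, exists_eq_or_imp, exists_eq_left,
    mem_compl]
  tauto

theorem splitting_injective : Function.Injective (splitting (m := m)) := by
  intro A B h
  have hA : A.map (Fin.succEmb m) ∈ splitting B := h ▸ mem_insert_self _ _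
  simp only [splitting, mem_insert, mem_singleton] at hA
  rcases hA with hA | hA
  · exact map_injective _ hA
  · have := Finset.ext_iff.1 hA 0
    simp [Fin.succ_ne_zero] at this

theorem isBipartition_splitting {A : Finset (Fin m)} (hA : A.Nonempty) :
    IsBipartition univ (splitting A) ∧ (splitting A).card = 2 := by
  have hne : A.map (Fin.succEmb m) ≠ (A.map (Fin.succEmb m))ᶜ := by
    intro h
    have := Finset.ext_iff.1 h 0
    rw [mem_compl] at this
    tauto
  have hcard : (splitting A).card = 2 := card_pair hne
  refine ⟨⟨hcard.le, ?_, ?_, ?_⟩, hcard⟩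
  · simp only [splitting, mem_insert, mem_singleton, forall_eq_or_imp, forall_eq]
    exact ⟨hA.map, ⟨0, by simp [Fin.succ_ne_zero]⟩⟩
  · simp only [splitting, mem_insert, mem_singleton, forall_eq_or_imp, forall_eq]
    exact ⟨⟨fun h => absurd rfl h, fun _ => disjoint_compl_right⟩,
      fun _ => disjoint_compl_left, fun h => absurd rfl h⟩
  · simp [splitting]

theorem exists_splitting_eq {P : Finset (Finset (Fin (m + 1)))} (hP : IsBipartition univ P)
    (hcard : P.card = 2) : ∃ A : Finset (Fin m), A.Nonempty ∧ splitting A = P := by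
  obtain ⟨-, hne, hdisj, hsup⟩ := hP
  obtain ⟨B, C, hBC, rfl⟩ := card_eq_two.1 hcard
  wlog h0 : (0 : Fin (m + 1)) ∉ B generalizing B C
  · rw [pair_comm] at hne hdisj hsup hcard ⊢
    refine this C B hBC.symm hcard hne hdisj hsup fun hC => ?_
    exact disjoint_left.1 (hdisj C (by simp) B (by simp) hBC.symm) hC (not_not.1 h0)
  have hC : C = Bᶜ := by
    have hd : Disjoint B C := hdisj B (by simp) C (by simp) hBC
    refine (IsCompl.compl_eq ⟨hd, ?_⟩).symm
    rw [codisjoint_iff]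
    simpa using hsup
  have hB : (univ.filter fun v : Fin m => v.succ ∈ B).map (Fin.succEmb m) = B := by
    ext x
    cases x using Fin.cases with
    | zero => simp [h0, Fin.succ_ne_zero]
    | succ v => simp
  refine ⟨univ.filter fun v => v.succ ∈ B, ?_, ?_⟩
  · rw [← map_nonempty (f := Fin.succEmb m), hB]
    exact hne B (by simp)
  · rw [splitting, hB, hC]

theorem isSeparating_image_splitting_insert_empty (F : Finset (Finset (Fin m))) :
    IsSeparating univ ((insert ∅ F).image splitting) ↔ IsSeparating univ (F.image splitting) := by
  simp [IsSeparating, cuts_splitting]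

theorem seqCount_isSeparating (i : ℕ) :
    seqCount (fun F : Finset (Finset (Fin m)) => IsSeparating univ (F.image splitting)) i ∅ =
      (2 ^ i - 1).descFactorial m := by
  have hcard : Nat.card (Fin m ↪ {s : Finset (Fin i) // s ≠ ∅}) = (2 ^ i - 1).descFactorial m := by
    rw [Nat.card_eq_fintype_card, Fintype.card_embedding_eq, Fintype.card_fin,
      Fintype.card_subtype_compl, Fintype.card_subtype_eq, Fintype.card_finset, Fintype.card_fin]
  have hsep : ∀ g : Fin i → Finset (Fin m),
      IsSeparating univ ((∅ ∪ univ.image g).image splitting) ↔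
        (Function.Injective fun v => univ.filter fun j => v ∈ g j) ∧
          ∀ v, (univ.filter fun j => v ∈ g j) ≠ ∅ := by
    intro g
    have hunfold : IsSeparating univ ((∅ ∪ univ.image g).image splitting) ↔
        (∀ v, ∃ j, v ∈ g j) ∧ ∀ v w, v ≠ w → ∃ j, ¬ (v ∈ g j ↔ w ∈ g j) := by
      simp [IsSeparating, cuts_splitting, Fin.forall_fin_succ, Fin.succ_ne_zero,
        (Fin.succ_ne_zero _).symm, forall_and]
    rw [hunfold, and_comm]
    refine and_congr ?_ ?_
    · refine forall₂_congr fun v w => ?_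
      rw [← not_forall, not_imp_not]
      simp [Finset.ext_iff]
    · simp [Finset.ext_iff]
  rw [← hcard]
  refine Nat.card_congr ⟨fun g => ⟨fun v => ⟨univ.filter fun j => v ∈ g.1 j, ((hsep g.1).1 g.2).2 v⟩,
      fun v w h => ((hsep g.1).1 g.2).1 (congrArg Subtype.val h)⟩,
    fun h => ⟨fun j => univ.filter fun v => j ∈ (h v).1, (hsep _).2 ?_⟩, ?_, ?_⟩
  · simp only [mem_filter, mem_univ, true_and, filter_univ_mem]
    exact ⟨fun v w hvw => h.injective (Subtype.ext hvw), fun v => (h v).2⟩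
  · intro g
    ext
    simp
  · intro h
    ext
    simp

open Classical in
theorem sigmaSep_succ_eq_card (k : ℕ) :
    sigmaSep (m + 1) k = #{F ∈ powersetCard k (univ.erase (∅ : Finset (Fin m))) |
      IsSeparating univ (F.image splitting)} := by
  rw [sigmaSep, ← Set.ncard_coe_finset,
    ← Set.ncard_image_of_injective _ (image_injective splitting_injective)]
  congr 1
  ext G
  simp only [Set.mem_ofPred_eq, Set.mem_image, mem_coe, mem_filter, mem_powersetCard]
  constructor
  · rintro ⟨hG, hs, hc⟩
    have hGim : ((univ.erase (∅ : Finset (Fin m))).filter fun A => splitting A ∈ G).image splitting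
        = G := by
      ext P
      simp only [mem_image, mem_filter, mem_erase, mem_univ, and_true]
      constructor
      · rintro ⟨A, ⟨-, hA⟩, rfl⟩
        exact hA
      · intro hP
        obtain ⟨A, hA, rfl⟩ := exists_splitting_eq (hG P hP).1 (hG P hP).2
        exact ⟨A, ⟨hA.ne_empty, hP⟩, rfl⟩
    refine ⟨_, ⟨⟨filter_subset _ _, ?_⟩, ?_⟩, hGim⟩
    · rw [← card_image_of_injective _ splitting_injective, hGim, hc]
    · rwa [hGim]
  · rintro ⟨F, ⟨⟨hF, hc⟩, hs⟩, rfl⟩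
    refine ⟨?_, hs, by rw [card_image_of_injective _ splitting_injective, hc]⟩
    intro P hP
    obtain ⟨A, hA, rfl⟩ := mem_image.1 hP
    exact isBipartition_splitting (nonempty_iff_ne_empty.2 (mem_erase.1 (hF hA)).1)

end Splitting

/-- For `2 ≤ n` and `1 ≤ k < 2 ^ (n - 1)`:
`σ_{n,k} = ((n−1)!/k!) · ∑_{i=1}^{k} (−1)^(k−i) · c(k+1, i+1) · C(2^i − 1, n − 1)`. -/
theorem sigmaSep_eq_sum_stirling1 (n k : ℕ) (hn : 2 ≤ n) (hk1 : 1 ≤ k)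
    (hk2 : k < 2 ^ (n - 1)) :
    (sigmaSep n k : ℚ) =
      ((n - 1).factorial : ℚ) / (k.factorial : ℚ) *
        ∑ i ∈ Finset.Icc 1 k, (-1 : ℚ) ^ (k - i) * (stirling1 (k + 1) (i + 1) : ℚ) *
          (((2 ^ i - 1).choose (n - 1) : ℕ) : ℚ) := by
  classical
  obtain ⟨m, rfl⟩ : ∃ m, n = m + 1 := ⟨n - 1, by omega⟩
  have hm : m ≠ 0 := by omega
  have key := factorial_mul_card_filter_powersetCard
    (fun F : Finset (Finset (Fin m)) => IsSeparating univ (F.image splitting)) ∅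
    isSeparating_image_splitting_insert_empty k
  simp only [seqCount_isSeparating] at key
  have hk : (k.factorial : ℚ) ≠ 0 := by exact_mod_cast k.factorial_ne_zero
  rw [sigmaSep_succ_eq_card, Nat.add_sub_cancel, div_mul_eq_mul_div, eq_div_iff hk, mul_comm, key,
    mul_sum, range_eq_Ico, sum_eq_sum_Ico_succ_bot (Nat.succ_pos k)]
  have h0 : (2 ^ 0 - 1).descFactorial m = 0 := Nat.descFactorial_eq_zero_iff_lt.2 (by omega)
  rw [h0, Nat.cast_zero, mul_zero, zero_add]
  refine sum_congr rfl fun i hi => ?_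
  have hik : i ≤ k := by
    have := (mem_Ico.1 hi).2
    omega
  have hsign : (-1 : ℚ) ^ (k + i) = (-1) ^ (k - i) := by
    rw [show k + i = k - i + 2 * i by omega, pow_add, pow_mul]
    simp
  rw [Nat.descFactorial_eq_factorial_mul_choose, hsign]
  push_cast
  ring
end

section
/- For all n, k with 2 ≤ n and 1 ≤ k < 2^(n−1), the number σ_{n,k} of separating families of k proper bipartitions of an n-element set satisfies σ_{n,k} = ∑_{i=1}^{n−1} (−1)^(n−1−i) · c(n, i+1) · C(2^i − 1, k), where c(·,·) is the unsigned Stirling number of the first kind and C(·,·) is the binomial coefficient. -/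
open Finset

variable {α : Type*} [DecidableEq α]

/-- `Distinguishes F T`: the members of `F` tell the elements of `T` apart from each other and from
a base point that lies in no member of `F`. -/
def Distinguishes (F : Finset (Finset α)) (T : Finset α) : Prop :=
  (∀ t ∈ T, ∃ A ∈ F, t ∈ A) ∧ ∀ t ∈ T, ∀ u ∈ T, t ≠ u → ∃ A ∈ F, ¬(t ∈ A ↔ u ∈ A)

instance (F : Finset (Finset α)) (T : Finset α) : Decidable (Distinguishes F T) :=
  inferInstanceAs (Decidable (_ ∧ _))

/-- The `k`-element subfamilies of `V` that distinguish the elements of `T`. -/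
def distinguishing (k : ℕ) (V : Finset (Finset α)) (T : Finset α) :
    Finset (Finset (Finset α)) :=
  {F ∈ V.powersetCard k | Distinguishes F T}

/-- Every nonempty trace on `T` is attained by exactly `2 ^ m` members of `V`, and the empty trace
by exactly `2 ^ m - 1` members. -/
def UniformTraces (V : Finset (Finset α)) (T : Finset α) (m : ℕ) : Prop :=
  ∀ p ⊆ T, #{A ∈ V | A ∩ T = p} + (if p = ∅ then 1 else 0) = 2 ^ m

lemma mem_distinguishing {k : ℕ} {V : Finset (Finset α)} {T : Finset α}
    {F : Finset (Finset α)} :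
    F ∈ distinguishing k V T ↔ (F ⊆ V ∧ #F = k) ∧ Distinguishes F T := by
  simp [distinguishing, mem_powersetCard]

lemma mem_distinguishing_filter {k : ℕ} {V : Finset (Finset α)} {T : Finset α}
    {F : Finset (Finset α)} (q : Finset α → Prop) [DecidablePred q] :
    F ∈ distinguishing k {A ∈ V | q A} T ↔ F ∈ distinguishing k V T ∧ ∀ A ∈ F, q A := by
  simp only [mem_distinguishing, subset_iff, mem_filter]
  grind

lemma inter_insert_eq_iff {A T p : Finset α} {a : α} (ha : a ∉ T) (hp : p ⊆ T) :
    A ∩ insert a T = p ↔ A ∩ T = p ∧ a ∉ A := by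
  have : a ∉ p := fun h => ha (hp h)
  grind

lemma inter_insert_eq_insert_iff {A T p : Finset α} {a : α} (ha : a ∉ T) (hp : p ⊆ T) :
    A ∩ insert a T = insert a p ↔ A ∩ T = p ∧ a ∈ A := by
  have : a ∉ p := fun h => ha (hp h)
  constructor
  · intro h
    have h1 : a ∈ A := by
      have : a ∈ A ∩ insert a T := h ▸ mem_insert_self a p
      grind
    refine ⟨?_, h1⟩
    ext x
    have := Finset.ext_iff.1 h x
    grind
  · rintro ⟨rfl, h⟩
    grind

namespace UniformTraces

variable {V : Finset (Finset α)} {T : Finset α} {a : α} {m : ℕ}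

lemma of_insert (h : UniformTraces V (insert a T) m) (ha : a ∉ T) :
    UniformTraces V T (m + 1) := by
  intro p hp
  have h1 := h p (hp.trans (subset_insert _ _))
  have h2 := h (insert a p) (insert_subset_insert _ hp)
  simp only [inter_insert_eq_iff ha hp] at h1
  simp only [inter_insert_eq_insert_iff ha hp, insert_ne_empty, if_false] at h2
  have h3 := card_filter_add_card_filter_not (s := {A ∈ V | A ∩ T = p}) (fun A => a ∈ A)
  simp only [filter_filter] at h3
  rw [pow_succ]
  omega

lemma filter_notMem (h : UniformTraces V (insert a T) m) (ha : a ∉ T) :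
    UniformTraces {A ∈ V | a ∉ A} T m := by
  intro p hp
  have h1 := h p (hp.trans (subset_insert _ _))
  simp only [inter_insert_eq_iff ha hp] at h1
  simp only [filter_filter]
  simpa only [and_comm] using h1

lemma filter_mem_iff (h : UniformTraces V (insert a T) m) (ha : a ∉ T) {t : α} (ht : t ∈ T) :
    UniformTraces {A ∈ V | a ∈ A ↔ t ∈ A} T m := by
  intro p hp
  rw [filter_filter]
  by_cases htp : t ∈ p
  · have h2 := h (insert a p) (insert_subset_insert _ hp)
    simp only [inter_insert_eq_insert_iff ha hp, insert_ne_empty, if_false] at h2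
    rw [if_neg (ne_empty_of_mem htp), ← h2]
    congr 2
    ext A
    simp only [mem_filter]
    grind
  · have h1 := h p (hp.trans (subset_insert _ _))
    simp only [inter_insert_eq_iff ha hp] at h1
    rw [← h1]
    congr 2
    ext A
    simp only [mem_filter]
    grind

end UniformTraces

lemma distinguishes_insert {F : Finset (Finset α)} {T : Finset α} {a : α} (ha : a ∉ T) :
    Distinguishes F (insert a T) ↔ Distinguishes F T ∧ (¬ ∀ A ∈ F, a ∉ A) ∧
      ∀ t ∈ T, ¬ ∀ A ∈ F, (a ∈ A ↔ t ∈ A) := by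
  simp only [Distinguishes, forall_mem_insert]
  push Not
  constructor
  · rintro ⟨⟨h1, h2⟩, h3, h4⟩
    refine ⟨⟨h2, fun t ht => (h4 t ht).2⟩, h1, fun t ht => ?_⟩
    obtain ⟨A, hA, h⟩ := h3.2 t ht (by rintro rfl; exact ha ht)
    exact ⟨A, hA, by tauto⟩
  · rintro ⟨⟨h1, h2⟩, h3, h4⟩
    have h5 : ∀ t ∈ T, ∃ A ∈ F, ¬(a ∈ A ↔ t ∈ A) := fun t ht => by
      obtain ⟨A, hA, h⟩ := h4 t ht
      exact ⟨A, hA, by tauto⟩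
    refine ⟨⟨h3, h1⟩, ⟨by simp, fun t ht _ => by simpa using h4 t ht⟩,
      fun t ht => ⟨fun _ => ?_, fun u hu hne => ?_⟩⟩
    · obtain ⟨A, hA, h⟩ := h5 t ht
      exact ⟨A, hA, by tauto⟩
    · simpa using h2 t ht u hu hne

lemma card_distinguishing_eq_add (k : ℕ) (V : Finset (Finset α)) {T : Finset α} {a : α}
    (ha : a ∉ T) :
    #(distinguishing k V T) = #(distinguishing k V (insert a T)) +
      (#(distinguishing k {A ∈ V | a ∉ A} T) +
        ∑ t ∈ T, #(distinguishing k {A ∈ V | a ∈ A ↔ t ∈ A} T)) := by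
  have hT : ∑ t ∈ T, #(distinguishing k {A ∈ V | a ∈ A ↔ t ∈ A} T) =
      #(T.biUnion fun t => distinguishing k {A ∈ V | a ∈ A ↔ t ∈ A} T) := by
    refine (card_biUnion fun t ht u hu htu => disjoint_left.2 fun F h1 h2 => ?_).symm
    rw [mem_distinguishing_filter] at h1 h2
    obtain ⟨A, hA, h⟩ := (mem_distinguishing.1 h1.1).2.2 t ht u hu htu
    exact h ((h1.2 A hA).symm.trans (h2.2 A hA))
  rw [hT, ← card_union_of_disjoint, ← card_union_of_disjoint]
  · congr 1
    ext F
    simp only [mem_union, mem_biUnion, mem_distinguishing_filter]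
    simp only [mem_distinguishing, distinguishes_insert ha]
    by_cases h1 : ∀ A ∈ F, a ∉ A <;> by_cases h2 : ∃ t ∈ T, ∀ A ∈ F, (a ∈ A ↔ t ∈ A) <;> grind
  · refine disjoint_left.2 fun F h1 h2 => ?_
    simp only [mem_union, mem_biUnion, mem_distinguishing_filter] at h2
    have h3 := (distinguishes_insert ha).1 (mem_distinguishing.1 h1).2
    grind
  · refine disjoint_left.2 fun F h1 h2 => ?_
    simp only [mem_biUnion, mem_distinguishing_filter] at h1 h2
    obtain ⟨t, ht, -, h⟩ := h2
    obtain ⟨A, hA, htA⟩ := (mem_distinguishing.1 h1.1).2.1 t ht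
    exact h1.2 A hA ((h A hA).2 htA)

lemma stirling1_eq_stirlingFirst : ∀ n k, stirling1 n k = Nat.stirlingFirst n k
  | 0, 0 => rfl
  | 0, _ + 1 => rfl
  | _ + 1, 0 => rfl
  | n + 1, k + 1 => by
    rw [stirling1, Nat.stirlingFirst_succ_succ, stirling1_eq_stirlingFirst n,
      stirling1_eq_stirlingFirst n]

lemma sum_stirling1_succ (r : ℕ) (f : ℕ → ℤ) :
    ∑ i ∈ range (r + 2), (-1 : ℤ) ^ (r + 1 + i) * (stirling1 (r + 2) (i + 1) : ℤ) * f i =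
      ∑ i ∈ range (r + 1), (-1 : ℤ) ^ (r + i) * (stirling1 (r + 1) (i + 1) : ℤ) * f (i + 1) -
      (r + 1) *
        ∑ i ∈ range (r + 1), (-1 : ℤ) ^ (r + i) * (stirling1 (r + 1) (i + 1) : ℤ) * f i := by
  have h0 : stirling1 (r + 1) (r + 1 + 1) = 0 := by
    rw [stirling1_eq_stirlingFirst]
    exact Nat.stirlingFirst_eq_zero_of_lt (by omega)
  have h1 : ∑ i ∈ range (r + 1), (-1 : ℤ) ^ (r + i) * (stirling1 (r + 1) (i + 1) : ℤ) * f i =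
      ∑ i ∈ range (r + 2), (-1 : ℤ) ^ (r + i) * (stirling1 (r + 1) (i + 1) : ℤ) * f i := by
    rw [sum_range_succ _ (r + 1), h0]
    simp
  have h2 : ∑ i ∈ range (r + 1), (-1 : ℤ) ^ (r + i) * (stirling1 (r + 1) (i + 1) : ℤ) * f (i + 1) =
      ∑ i ∈ range (r + 2), (-1 : ℤ) ^ (r + 1 + i) * (stirling1 (r + 1) i : ℤ) * f i := by
    rw [sum_range_succ' _ (r + 1)]
    simp only [stirling1, Nat.cast_zero, mul_zero, zero_mul, add_zero]
    exact sum_congr rfl fun i _ => by ring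
  rw [h1, h2, mul_sum, ← sum_sub_distrib]
  refine sum_congr rfl fun i _ => ?_
  rw [stirling1]
  push_cast
  ring

theorem card_distinguishing (k : ℕ) (T : Finset α) : ∀ (V : Finset (Finset α)) (m : ℕ),
    UniformTraces V T m → (#(distinguishing k V T) : ℤ) =
      ∑ i ∈ range (#T + 1), (-1 : ℤ) ^ (#T + i) * (stirling1 (#T + 1) (i + 1) : ℤ) *
        (((2 ^ (i + m) - 1).choose k : ℕ) : ℤ) := by
  induction T using Finset.induction_on with
  | empty =>
    intro V m h
    have hV : #V = 2 ^ m - 1 := by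
      have := h ∅ subset_rfl
      simp at this
      omega
    simp [distinguishing, Distinguishes, stirling1, hV]
  | insert a T ha ih =>
    intro V m h
    have hrec := congrArg (Nat.cast : ℕ → ℤ) (card_distinguishing_eq_add k V ha)
    push_cast at hrec
    rw [ih _ _ (h.of_insert ha), ih _ _ (h.filter_notMem ha),
      sum_congr rfl fun t ht => ih _ _ (h.filter_mem_iff ha ht), sum_const, nsmul_eq_mul] at hrec
    have hsum :=
      sum_stirling1_succ #T fun i => (((2 ^ (i + m) - 1).choose k : ℕ) : ℤ)
    simp only [add_right_comm _ 1 m, add_assoc _ m 1] at hsum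
    rw [card_insert_of_notMem ha]
    linarith

section Bipartitions

variable {r : ℕ}

/-- The nonempty subsets of `Fin (r + 1)` that avoid the base point `0`. -/
def nonemptyAvoidingZero (r : ℕ) : Finset (Finset (Fin (r + 1))) :=
  {A | A.Nonempty ∧ 0 ∉ A}

lemma uniformTraces_nonemptyAvoidingZero :
    UniformTraces (nonemptyAvoidingZero r) (univ.erase 0) 0 := by
  intro p hp
  have h0 : 0 ∉ p := fun h => by simpa using hp h
  have : ({A ∈ nonemptyAvoidingZero r | A ∩ univ.erase 0 = p}) = if p = ∅ then ∅ else {p} := by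
    ext A
    have hA : 0 ∉ A → A ∩ univ.erase 0 = A := fun h => by
      rw [inter_erase, inter_univ, erase_eq_of_notMem h]
    simp only [nonemptyAvoidingZero, mem_filter, mem_univ, true_and]
    split_ifs with h
    · subst h
      simp only [notMem_empty, iff_false]
      rintro ⟨⟨h1, h2⟩, h3⟩
      rw [hA h2] at h3
      exact h1.ne_empty h3
    · rw [mem_singleton]
      constructor
      · rintro ⟨⟨h1, h2⟩, h3⟩
        rwa [hA h2] at h3
      · rintro rfl
        exact ⟨⟨nonempty_iff_ne_empty.2 h, h0⟩, hA h0⟩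
  rw [this]
  split_ifs <;> simp

/-- The bipartition into `A` and its complement. -/
def bipartitionOf (A : Finset (Fin (r + 1))) : Finset (Finset (Fin (r + 1))) := {A, Aᶜ}

lemma cuts_bipartitionOf {A : Finset (Fin (r + 1))} {x y : Fin (r + 1)} :
    Cuts (bipartitionOf A) x y ↔ ¬(x ∈ A ↔ y ∈ A) := by
  simp only [Cuts, bipartitionOf, mem_insert, mem_singleton]
  constructor
  · rintro ⟨B, rfl | rfl, C, rfl | rfl, hne, hx, hy⟩ <;> simp_all
  · intro h
    have hA : A ≠ Aᶜ := fun h' => by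
      have := Finset.ext_iff.1 h' x
      simp at this
    by_cases hx : x ∈ A
    · exact ⟨A, .inl rfl, Aᶜ, .inr rfl, hA, hx, by simp; tauto⟩
    · exact ⟨Aᶜ, .inr rfl, A, .inl rfl, hA.symm, by simpa, by tauto⟩

lemma bipartitionOf_injOn :
    Set.InjOn bipartitionOf (nonemptyAvoidingZero r : Set (Finset (Fin (r + 1)))) := by
  intro A hA B hB h
  simp only [nonemptyAvoidingZero, coe_filter, mem_univ, true_and, Set.mem_ofPred_eq] at hA hB
  have h1 : A ∈ bipartitionOf B := h ▸ mem_insert_self _ _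
  simp only [bipartitionOf, mem_insert, mem_singleton] at h1
  rcases h1 with h1 | h1
  · exact h1
  · exact absurd (h1 ▸ mem_compl.2 hB.2) hA.2

lemma isBipartition_bipartitionOf {A : Finset (Fin (r + 1))} (hA : A ∈ nonemptyAvoidingZero r) :
    IsBipartition univ (bipartitionOf A) ∧ #(bipartitionOf A) = 2 := by
  simp only [nonemptyAvoidingZero, mem_filter, mem_univ, true_and] at hA
  have hne : A ≠ Aᶜ := fun h => hA.2 (h ▸ mem_compl.2 hA.2)
  have hc : #(bipartitionOf A) = 2 := card_pair hne
  refine ⟨⟨hc.le, ?_, ?_, ?_⟩, hc⟩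
  · simp only [bipartitionOf, forall_mem_insert, mem_singleton, forall_eq]
    exact ⟨hA.1, 0, mem_compl.2 hA.2⟩
  · simp only [bipartitionOf, mem_insert, mem_singleton]
    rintro B (rfl | rfl) C (rfl | rfl) h
    · exact absurd rfl h
    · exact disjoint_compl_right
    · exact disjoint_compl_left
    · exact absurd rfl h
  · simp [bipartitionOf]

lemma exists_bipartitionOf_eq {P : Finset (Finset (Fin (r + 1)))} (hP : IsBipartition univ P)
    (hc : #P = 2) : ∃ A ∈ nonemptyAvoidingZero r, bipartitionOf A = P := by
  obtain ⟨A, B, hne, rfl⟩ := card_eq_two.1 hc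
  obtain ⟨-, h1, h2, h3⟩ := hP
  have hd : Disjoint A B := h2 A (by simp) B (by simp) hne
  have hu : A ∪ B = univ := by simpa using h3
  have hAB : IsCompl A B := ⟨hd, codisjoint_iff.2 hu⟩
  by_cases h0 : 0 ∈ A
  · refine ⟨B, ?_, ?_⟩
    · simp only [nonemptyAvoidingZero, mem_filter, mem_univ, true_and]
      exact ⟨h1 B (by simp), disjoint_left.1 hd h0⟩
    · rw [bipartitionOf, hAB.symm.compl_eq, pair_comm]
  · refine ⟨A, ?_, ?_⟩
    · simp only [nonemptyAvoidingZero, mem_filter, mem_univ, true_and]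
      exact ⟨h1 A (by simp), h0⟩
    · rw [bipartitionOf, hAB.compl_eq]

lemma isSeparating_image_iff {F : Finset (Finset (Fin (r + 1)))}
    (hF : F ⊆ nonemptyAvoidingZero r) :
    IsSeparating univ (F.image bipartitionOf) ↔ Distinguishes F (univ.erase 0) := by
  have h0 : ∀ A ∈ F, 0 ∉ A := fun A hA => by
    have := hF hA
    simp only [nonemptyAvoidingZero, mem_filter] at this
    exact this.2.2
  simp only [IsSeparating, mem_univ, true_imp_iff, exists_mem_image, cuts_bipartitionOf,
    Distinguishes, mem_erase, and_true]
  constructor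
  · intro h
    refine ⟨fun t ht => ?_, fun t _ u _ htu => h t u htu⟩
    obtain ⟨A, hA, h⟩ := h t 0 ht
    exact ⟨A, hA, by simpa [h0 A hA] using h⟩
  · rintro ⟨h1, h2⟩ x y hxy
    by_cases hx : x = 0
    · obtain ⟨A, hA, h⟩ := h1 y (by rintro rfl; exact hxy hx)
      exact ⟨A, hA, by simp [hx, h0 A hA, h]⟩
    · by_cases hy : y = 0
      · obtain ⟨A, hA, h⟩ := h1 x hx
        exact ⟨A, hA, by simp [hy, h0 A hA, h]⟩
      · exact h2 x hx y hy hxy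

theorem sigmaSep_succ_eq_card_distinguishing (r k : ℕ) :
    sigmaSep (r + 1) k = #(distinguishing k (nonemptyAvoidingZero r) (univ.erase 0)) := by
  have hset : {F : Finset (Finset (Finset (Fin (r + 1)))) |
      (∀ P ∈ F, IsBipartition univ P ∧ P.card = 2) ∧ IsSeparating univ F ∧ F.card = k} =
      image bipartitionOf ''
        (distinguishing k (nonemptyAvoidingZero r) (univ.erase 0) : Set _) := by
    ext G
    simp only [Set.mem_ofPred_eq, Set.mem_image, mem_coe, mem_distinguishing]
    constructor
    · rintro ⟨h1, h2, h3⟩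
      obtain ⟨F, hF, rfl⟩ := subset_image_iff.1
        (show G ⊆ (nonemptyAvoidingZero r).image bipartitionOf from
          fun P hP => mem_image.2 (exists_bipartitionOf_eq (h1 P hP).1 (h1 P hP).2))
      rw [card_image_of_injOn (bipartitionOf_injOn.mono hF)] at h3
      exact ⟨F, ⟨⟨hF, h3⟩, (isSeparating_image_iff hF).1 h2⟩, rfl⟩
    · rintro ⟨F, ⟨⟨hF, hk⟩, hd⟩, rfl⟩
      refine ⟨?_, (isSeparating_image_iff hF).2 hd, ?_⟩
      · simp only [forall_mem_image]
        exact fun A hA => isBipartition_bipartitionOf (hF hA)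
      · rw [card_image_of_injOn (bipartitionOf_injOn.mono hF), hk]
  rw [sigmaSep, hset, Set.InjOn.ncard_image, Set.ncard_coe_finset]
  intro F hF G hG h
  have hF' := (mem_distinguishing.1 (mem_coe.1 hF)).1.1
  have hG' := (mem_distinguishing.1 (mem_coe.1 hG)).1.1
  have h' := congrArg ((↑) : Finset _ → Set (Finset (Finset (Fin (r + 1))))) h
  simp only [coe_image] at h'
  exact coe_injective ((bipartitionOf_injOn.image_eq_image_iff hF' hG').1 h')

end Bipartitions

/-- For `2 ≤ n` and `1 ≤ k < 2 ^ (n - 1)`: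
`σ_{n,k} = ∑_{i=1}^{n−1} (−1)^(n−1−i) · c(n, i+1) · C(2^i − 1, k)`. -/
theorem sigmaSep_eq_sum_stirling1' (n k : ℕ) (hn : 2 ≤ n) (hk1 : 1 ≤ k)
    (hk2 : k < 2 ^ (n - 1)) :
    (sigmaSep n k : ℤ) =
      ∑ i ∈ Finset.Icc 1 (n - 1), (-1 : ℤ) ^ (n - 1 - i) * (stirling1 n (i + 1) : ℤ) *
        (((2 ^ i - 1).choose k : ℕ) : ℤ) := by
  obtain ⟨r, rfl⟩ : ∃ r, n = r + 1 := ⟨n - 1, by omega⟩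
  rw [sigmaSep_succ_eq_card_distinguishing,
    card_distinguishing k _ _ 0 uniformTraces_nonemptyAvoidingZero]
  have hT : #((univ : Finset (Fin (r + 1))).erase 0) = r := by simp
  rw [hT, Nat.add_sub_cancel, sum_range_eq_add_Ico _ (Nat.succ_pos r)]
  have hz : (2 ^ (0 + 0) - 1).choose k = 0 := Nat.choose_eq_zero_of_lt (by simp; omega)
  rw [hz, Nat.cast_zero, mul_zero, zero_add]
  refine sum_congr rfl fun i hi => ?_
  have hi' : r + i = (r - i) + 2 * i := by
    rw [mem_Icc] at hi
    omega
  rw [hi', pow_add, pow_mul, neg_one_sq, one_pow, mul_one, add_zero]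
end

section
/- For every k ≥ 1, the minimum size n of a finite set admitting a separating family of k proper bipartitions is ⌈log₂(k+1)⌉ + 1; that is, if a set of n elements admits a separating family of k proper bipartitions then n ≥ ⌈log₂(k+1)⌉ + 1, and a set of ⌈log₂(k+1)⌉ + 1 elements admits such a family. -/
open Finset

variable {α : Type*} [DecidableEq α]

/-- The nonempty subsets of `S` that avoid `x`; for `x ∈ S` they parametrize the proper
bipartitions of `S`. -/
def subsetsAvoiding (S : Finset α) (x : α) : Finset (Finset α) :=
  (S.erase x).powerset.erase ∅

theorem mem_subsetsAvoiding {S T : Finset α} {x : α} :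
    T ∈ subsetsAvoiding S x ↔ T.Nonempty ∧ T ⊆ S ∧ x ∉ T := by
  simp [subsetsAvoiding, subset_erase, nonempty_iff_ne_empty]

theorem card_subsetsAvoiding {S : Finset α} {x : α} (hx : x ∈ S) :
    (subsetsAvoiding S x).card = 2 ^ (S.card - 1) - 1 := by
  rw [subsetsAvoiding, card_erase_of_mem (empty_mem_powerset _), card_powerset,
    card_erase_of_mem hx]

/-- The bipartition of `S` into `T` and its complement. -/
def splitAt (S T : Finset α) : Finset (Finset α) := {T, S \ T}

theorem splitAt_injOn {S : Finset α} {x : α} (hx : x ∈ S) :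
    Set.InjOn (splitAt S) (subsetsAvoiding S x : Set (Finset α)) := by
  intro T hT U hU h
  have hT' := (mem_subsetsAvoiding.1 hT).2.2
  have hU' := (mem_subsetsAvoiding.1 hU).2.2
  have hmem : T ∈ splitAt S U := h ▸ mem_insert_self _ _
  rcases mem_insert.1 hmem with h1 | h1
  · exact h1
  · rw [mem_singleton.1 h1] at hT'
    exact absurd (mem_sdiff.2 ⟨hx, hU'⟩) hT'

theorem isBipartition_splitAt {S T : Finset α} {x : α} (hx : x ∈ S)
    (hT : T ∈ subsetsAvoiding S x) :
    IsBipartition S (splitAt S T) ∧ (splitAt S T).card = 2 := by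
  obtain ⟨hne, hsub, hxT⟩ := mem_subsetsAvoiding.1 hT
  have hxc : x ∈ S \ T := mem_sdiff.2 ⟨hx, hxT⟩
  have hcard : (splitAt S T).card = 2 :=
    card_pair fun h => hxT (h ▸ hxc)
  refine ⟨⟨hcard.le, ?_, ?_, ?_⟩, hcard⟩
  · simpa [splitAt] using ⟨hne, ⟨x, hxc⟩⟩
  · simp only [splitAt, mem_insert, mem_singleton]
    rintro A (rfl | rfl) B (rfl | rfl) h
    · exact absurd rfl h
    · exact disjoint_sdiff
    · exact sdiff_disjoint
    · exact absurd rfl h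
  · simpa [splitAt] using hsub

theorem cuts_splitAt {S T : Finset α} {a b : α} (hb : b ∈ S) (haT : a ∈ T) (hbT : b ∉ T) :
    Cuts (splitAt S T) a b :=
  ⟨T, by simp [splitAt], S \ T, by simp [splitAt],
    fun h => (mem_sdiff.1 (h ▸ haT : a ∈ S \ T)).2 haT, haT, mem_sdiff.2 ⟨hb, hbT⟩⟩

theorem Cuts.symm {β : Type*} {P : Finset (Finset β)} {a b : β} (h : Cuts P a b) : Cuts P b a := by
  obtain ⟨A, hA, B, hB, hne, ha, hb⟩ := h
  exact ⟨B, hB, A, hA, hne.symm, hb, ha⟩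

theorem IsBipartition.exists_eq_splitAt {S : Finset α} {P : Finset (Finset α)} {x : α}
    (hx : x ∈ S) (hP : IsBipartition S P) (hcard : P.card = 2) :
    ∃ T ∈ subsetsAvoiding S x, splitAt S T = P := by
  obtain ⟨A, B, hAB, rfl⟩ := card_eq_two.1 hcard
  obtain ⟨-, hne, hdisj, hsup⟩ := hP
  have hd : Disjoint A B := hdisj A (by simp) B (by simp) hAB
  have hS : A ∪ B = S := by simpa using hsup
  subst hS
  by_cases hxA : x ∈ A
  · refine ⟨B, mem_subsetsAvoiding.2 ⟨hne B (by simp), subset_union_right,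
      disjoint_left.1 hd hxA⟩, ?_⟩
    rw [splitAt, union_sdiff_cancel_right hd, pair_comm]
  · refine ⟨A, mem_subsetsAvoiding.2 ⟨hne A (by simp), subset_union_left, hxA⟩, ?_⟩
    rw [splitAt, union_sdiff_cancel_left hd]

/-- There are at most `2 ^ (n - 1) - 1` proper bipartitions of a set of `n ≥ 1` elements. -/
theorem card_le_of_forall_isBipartition {S : Finset α} (hS : S.Nonempty)
    {F : Finset (Finset (Finset α))} (hF : ∀ P ∈ F, IsBipartition S P ∧ P.card = 2) :
    F.card ≤ 2 ^ (S.card - 1) - 1 := by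
  obtain ⟨x, hx⟩ := hS
  rw [← card_subsetsAvoiding hx]
  refine (card_le_card fun P hP => ?_).trans (card_image_le (f := splitAt S))
  obtain ⟨T, hT, hTP⟩ := (hF P hP).1.exists_eq_splitAt hx (hF P hP).2
  exact mem_image.2 ⟨T, hT, hTP⟩

/-- A nonempty set of `n` elements has separating families of `k` proper bipartitions whenever
`n - 1 ≤ k ≤ 2 ^ (n - 1) - 1`. -/
theorem exists_isSeparating_card_eq {S : Finset α} (hS : S.Nonempty) {k : ℕ}
    (hk : S.card - 1 ≤ k) (hk' : k ≤ 2 ^ (S.card - 1) - 1) :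
    ∃ F : Finset (Finset (Finset α)),
      (∀ P ∈ F, IsBipartition S P ∧ P.card = 2) ∧ IsSeparating S F ∧ F.card = k := by
  obtain ⟨x, hx⟩ := hS
  have hsub : (S.erase x).image singleton ⊆ subsetsAvoiding S x := by
    intro T hT
    obtain ⟨a, ha, rfl⟩ := mem_image.1 hT
    rw [mem_erase] at ha
    exact mem_subsetsAvoiding.2 ⟨singleton_nonempty a, by simpa using ha.2,
      by simpa using ha.1.symm⟩
  have hcard : ((S.erase x).image (singleton : α → Finset α)).card ≤ k := by
    rwa [card_image_of_injective _ singleton_injective, card_erase_of_mem hx]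
  obtain ⟨G, hG, hGsub, hGcard⟩ :=
    exists_subsuperset_card_eq hsub hcard (by rwa [card_subsetsAvoiding hx])
  have hsep : ∀ a ∈ S, a ≠ x → ∀ b ∈ S, a ≠ b → ∃ P ∈ G.image (splitAt S), Cuts P a b :=
    fun a ha hax b hb hab => ⟨splitAt S {a},
      mem_image_of_mem _ (hG (mem_image_of_mem _ (mem_erase.2 ⟨hax, ha⟩))),
      cuts_splitAt hb (mem_singleton_self a) (by simpa using hab.symm)⟩
  refine ⟨G.image (splitAt S), ?_, fun a ha b hb hab => ?_, ?_⟩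
  · intro P hP
    obtain ⟨T, hT, rfl⟩ := mem_image.1 hP
    exact isBipartition_splitAt hx (hGsub hT)
  · by_cases hax : a = x
    · obtain ⟨P, hP, hcut⟩ := hsep b hb (fun h => hab (hax.trans h.symm)) a ha hab.symm
      exact ⟨P, hP, hcut.symm⟩
    · exact hsep a ha hax b hb hab
  · rw [card_image_of_injOn ((splitAt_injOn hx).mono (by exact_mod_cast hGsub)), hGcard]

/-- For every `k ≥ 1`, the minimum size of a finite set admitting a separating family of
`k` proper bipartitions is `⌈log₂ (k+1)⌉ + 1`. -/
theorem minSize_set_separating_proper (k : ℕ) (hk : 1 ≤ k) :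
    (∀ (α : Type) [DecidableEq α] (S : Finset α),
      ∀ F : Finset (Finset (Finset α)),
        (∀ P ∈ F, IsBipartition S P ∧ P.card = 2) →
        IsSeparating S F → F.card = k → Nat.clog 2 (k + 1) + 1 ≤ S.card) ∧
    ∃ F : Finset (Finset (Finset (Fin (Nat.clog 2 (k + 1) + 1)))),
      (∀ P ∈ F, IsBipartition Finset.univ P ∧ P.card = 2) ∧
        IsSeparating Finset.univ F ∧ F.card = k := by
  refine ⟨fun α _ S F hF _ hcard => ?_, ?_⟩
  · have hS : S.Nonempty := by
      obtain ⟨P, hP⟩ := card_pos.1 (hcard ▸ hk : 0 < F.card)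
      obtain ⟨⟨-, hne, -, hsup⟩, h2⟩ := hF P hP
      obtain ⟨A, hA⟩ := card_pos.1 (by lia : 0 < P.card)
      exact (hne A hA).mono (hsup ▸ le_sup (f := id) hA)
    have h := card_le_of_forall_isBipartition hS hF
    have hpos : 0 < 2 ^ (S.card - 1) := by positivity
    have hlog : Nat.clog 2 (k + 1) ≤ S.card - 1 := Nat.clog_le_of_le_pow (by lia)
    have := hS.card_pos
    lia
  · have hle : k + 1 ≤ 2 ^ Nat.clog 2 (k + 1) := Nat.le_pow_clog (by norm_num) _
    have hlt : 2 ^ (Nat.clog 2 (k + 1) - 1) < k + 1 :=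
      Nat.pow_pred_clog_lt_self (by norm_num) (by lia)
    have hself : Nat.clog 2 (k + 1) - 1 < 2 ^ (Nat.clog 2 (k + 1) - 1) := Nat.lt_two_pow_self
    apply exists_isSeparating_card_eq univ_nonempty
    · simp only [card_univ, Fintype.card_fin]
      lia
    · simp only [card_univ, Fintype.card_fin, Nat.add_sub_cancel]
      lia
end
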